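/- arXiv:2411.04391 — 2 statements merged into one kernel-verified Lean document; each statement's English description precedes it below -/
import Mathlib

section
/- Consider an IDO chore instance with n agents in which every cost function v_i is factored. If HFFD is run with each agent i's threshold equal to their maximin share, τ_i = MMS^n(v_i, M), then HFFD allocates all chores. -/
open Finset

variable {α : Type*} [DecidableEq α]

/-- The total cost of a bundle `S` of chores under the additive cost function `v`. -/
def bundleCost (v : α → ℚ) (S : Finset α) : ℚ := ∑ c ∈ S, v c

/-- `P` is a partition of `M` into `d` (possibly empty) bundles. -/
def IsPartitionInto (M : Finset α) (d : ℕ) (P : Fin d → Finset α) : Prop :=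
  (∀ j, P j ⊆ M) ∧ (∀ j k, j ≠ k → Disjoint (P j) (P k)) ∧ ∀ c ∈ M, ∃ j, c ∈ P j

/-- `μ` is the `d`-maximin share `MMS^d(v, M)`: the minimum, over all partitions of `M`
into `d` bundles, of the maximum bundle cost. -/
def IsMMS (v : α → ℚ) (M : Finset α) (d : ℕ) (μ : ℚ) : Prop :=
  (∃ P : Fin d → Finset α, IsPartitionInto M d P ∧ ∀ j, bundleCost v (P j) ≤ μ) ∧
    ∀ P : Fin d → Finset α, IsPartitionInto M d P → ∃ j, μ ≤ bundleCost v (P j)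

/-- Build one HFFD bundle: scan the remaining chores in order, adding a chore iff after
adding it the bundle's cost is at most `τ i` under `v i` for at least one remaining agent `i`. -/
def hffdBundle {n : ℕ} (v : Fin n → α → ℚ) (τ : Fin n → ℚ)
    (Ag : Finset (Fin n)) : List α → Finset α → Finset α
  | [], B => B
  | c :: R, B =>
      if ∃ i ∈ Ag, bundleCost (v i) (insert c B) ≤ τ i then
        hffdBundle v τ Ag R (insert c B)
      else hffdBundle v τ Ag R B

/-- The state of HFFD (remaining chores, remaining agents) after `k` bundles have been
built, where `σ j` is the agent to whom the `j`-th bundle is assigned. -/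
def hffdState {n : ℕ} (v : Fin n → α → ℚ) (τ : Fin n → ℚ)
    (L : List α) (σ : ℕ → Fin n) : ℕ → List α × Finset (Fin n)
  | 0 => (L, Finset.univ)
  | k + 1 =>
      let s := hffdState v τ L σ k
      let B := hffdBundle v τ s.2 s.1 ∅
      (s.1.filter fun c => c ∉ B, s.2.erase (σ k))

/-- The `k`-th bundle built by HFFD (0-indexed). -/
def hffdBundleAt {n : ℕ} (v : Fin n → α → ℚ) (τ : Fin n → ℚ)
    (L : List α) (σ : ℕ → Fin n) (k : ℕ) : Finset α :=
  hffdBundle v τ (hffdState v τ L σ k).2 (hffdState v τ L σ k).1 ∅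

/-- `σ` is a valid execution of HFFD: each bundle is assigned to a remaining agent
for whom its cost is at most that agent's threshold. -/
def ValidHFFDRun {n : ℕ} (v : Fin n → α → ℚ) (τ : Fin n → ℚ)
    (L : List α) (σ : ℕ → Fin n) : Prop :=
  ∀ k < n, σ k ∈ (hffdState v τ L σ k).2 ∧
    bundleCost (v (σ k)) (hffdBundleAt v τ L σ k) ≤ τ (σ k)

/-- `L` is a universal ordering witnessing that the instance is IDO: an enumeration of `M`
that is non-increasing w.r.t. every agent's cost function. -/
def IsUniversalOrder {n : ℕ} (v : Fin n → α → ℚ) (M : Finset α) (L : List α) : Prop :=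
  L.toFinset = M ∧ L.Nodup ∧ ∀ i, L.Pairwise fun c c' => v i c' ≤ v i c

/-- `v` is factored on `M`: any two cost values are comparable under divisibility,
the smaller dividing the larger with a positive integer quotient. -/
def Factored (v : α → ℚ) (M : Finset α) : Prop :=
  ∀ c ∈ M, ∀ c' ∈ M, v c ≤ v c' → ∃ q : ℕ, 0 < q ∧ v c' = q * v c

/-- `S` can be packed into `d` bundles of cost at most `t`. -/
def Pack (v : α → ℚ) (t : ℚ) (d : ℕ) (S : Finset α) : Prop :=
  ∃ f : α → ℕ, (∀ c ∈ S, f c < d) ∧ ∀ j < d, ∑ c ∈ S with f c = j, v c ≤ t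

/-- Exact subset sums along a divisibility chain. -/
lemma exact_subset (v : α → ℚ) (T : Finset α) : (∀ c ∈ T, 0 < v c) →
    (∀ c ∈ T, ∀ c' ∈ T, v c ≤ v c' → ∃ q : ℕ, 0 < q ∧ v c' = q * v c) →
    ∀ x : ℚ, 0 ≤ x → (∀ c ∈ T, ∃ k : ℕ, x = k * v c) → x ≤ ∑ c ∈ T, v c →
    ∃ T' ⊆ T, ∑ c ∈ T', v c = x := by
  induction T using Finset.induction_on_max_value v with
  | empty =>
    intro _ _ x hx _ hle
    exact ⟨∅, by simp, by simp at hle ⊢; linarith⟩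
  | insert a s ha hmax ih =>
    intro hpos hfac x hx hdiv hle
    rcases hx.eq_or_lt with h0 | h0
    · exact ⟨∅, by simp, by simpa using h0⟩
    have hapos := hpos a (mem_insert_self _ _)
    obtain ⟨k, hk⟩ := hdiv a (mem_insert_self _ _)
    have hk1 : 1 ≤ k := by
      rcases Nat.eq_zero_or_pos k with h | h
      · subst h; simp at hk; linarith
      · exact h
    have hax : v a ≤ x := by
      have : (1 : ℚ) ≤ k := by exact_mod_cast hk1
      nlinarith
    rw [sum_insert ha] at hle
    obtain ⟨T', hT', hs⟩ := ih (fun c hc => hpos c (mem_insert_of_mem hc))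
      (fun c hc c' hc' => hfac c (mem_insert_of_mem hc) c' (mem_insert_of_mem hc'))
      (x - v a) (by linarith)
      (by
        intro c hc
        obtain ⟨q, hq, hqe⟩ := hfac c (mem_insert_of_mem hc) a (mem_insert_self _ _) (hmax c hc)
        refine ⟨(k - 1) * q, ?_⟩
        push_cast [Nat.cast_sub hk1]
        rw [hk, hqe]; ring)
      (by linarith)
    refine ⟨insert a T', insert_subset_insert _ hT', ?_⟩
    rw [sum_insert (fun h => ha (hT' h)), hs]; ring

lemma subset_hffdBundle {n : ℕ} (v : Fin n → α → ℚ) (τ : Fin n → ℚ)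
    (Ag : Finset (Fin n)) (R : List α) : ∀ B, B ⊆ hffdBundle v τ Ag R B := by
  induction R with
  | nil => intro B; simp [hffdBundle]
  | cons c R ih =>
    intro B
    unfold hffdBundle
    split_ifs
    · exact (subset_insert _ _).trans (ih _)
    · exact ih _

lemma key {n : ℕ} (v : Fin n → α → ℚ) (τ : Fin n → ℚ)
    (Ag : Finset (Fin n)) (i : Fin n) (hi : i ∈ Ag) (d : ℕ) (R : List α) :
    ∀ (S B : Finset α) (f : α → ℕ), (∀ c ∈ S, 0 < v i c) → Factored (v i) S →
      R.Nodup → R.Pairwise (fun c c' => v i c' ≤ v i c) → (∀ c ∈ R, c ∈ S) → Disjoint S B →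
      (∀ c ∈ S, f c ≤ d) → (∀ c ∈ S, f c = d → c ∈ R) →
      (∀ j < d, ∑ c ∈ S with f c = j, v i c ≤ τ i) →
      ((∀ c ∈ S, f c ≠ d) ∨ bundleCost (v i) B + ∑ c ∈ S with f c = d, v i c ≤ τ i) →
      Pack (v i) (τ i) d (S \ hffdBundle v τ Ag R B) := by
  induction R with
  | nil =>
    intro S B f hpos hfac _ _ _ hdis hfd hfR hsum _
    have : S \ hffdBundle v τ Ag [] B = S := by
      simpa [hffdBundle] using hdis
    rw [this]
    refine ⟨f, fun c hc => lt_of_le_of_ne (hfd c hc) fun h => ?_, hsum⟩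
    simpa using hfR c hc h
  | cons c R ih =>
    intro S B f hpos hfac hnd hpw hRS hdis hfd hfR hsum hQ
    have hcS : c ∈ S := hRS c (by simp)
    have hcB : c ∉ B := fun h => (Finset.disjoint_left.mp hdis) hcS h
    rw [List.nodup_cons] at hnd
    rw [List.pairwise_cons] at hpw
    have hcost : bundleCost (v i) (insert c B) = v i c + bundleCost (v i) B := by
      simp [bundleCost, sum_insert hcB]
    unfold hffdBundle
    split_ifs with hadd
    · have hS : S \ hffdBundle v τ Ag R (insert c B)
          = S.erase c \ hffdBundle v τ Ag R (insert c B) := by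
        have := subset_hffdBundle v τ Ag R (insert c B) (mem_insert_self c B)
        ext x
        simp only [mem_sdiff, mem_erase]
        constructor
        · rintro ⟨h1, h2⟩
          exact ⟨⟨fun h => h2 (h ▸ this), h1⟩, h2⟩
        · rintro ⟨⟨_, h1⟩, h2⟩
          exact ⟨h1, h2⟩
      rw [hS]
      have hsub : ∀ x ∈ S.erase c, x ∈ S := fun x hx => mem_of_mem_erase hx
      have hpos' : ∀ x ∈ S.erase c, 0 < v i x := fun x hx => hpos x (hsub x hx)
      have hfac' : Factored (v i) (S.erase c) :=
        fun x hx y hy => hfac x (hsub x hx) y (hsub y hy)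
      have hRS' : ∀ x ∈ R, x ∈ S.erase c := fun x hx =>
        mem_erase.mpr ⟨fun h => hnd.1 (h ▸ hx), hRS x (by simp [hx])⟩
      have hdis' : Disjoint (S.erase c) (insert c B) := by
        rw [Finset.disjoint_insert_right]
        exact ⟨by simp, hdis.mono_left (erase_subset _ _)⟩
      by_cases hfc : f c = d
      · refine ih (S.erase c) (insert c B) f hpos' hfac' hnd.2 hpw.2 hRS' hdis'
          (fun x hx => hfd x (hsub x hx)) ?_ ?_ ?_
        · intro x hx h
          have := hfR x (hsub x hx) h
          rcases List.mem_cons.mp this with h1 | h1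
          · exact absurd h1 (mem_erase.mp hx).1
          · exact h1
        · intro j hj
          refine le_trans (sum_le_sum_of_subset_of_nonneg ?_ ?_) (hsum j hj)
          · exact filter_subset_filter _ (erase_subset _ _)
          · intro x hx _
            exact (hpos x (mem_filter.mp hx).1).le
        · rcases hQ with h | h
          · exact absurd hfc (h c hcS)
          · right
            have h1 : (S.erase c).filter (fun x => f x = d) = (S.filter (fun x => f x = d)).erase c := by
              rw [filter_erase]
            have h2 := add_sum_erase (S.filter (fun x => f x = d)) (v i)
              (mem_filter.mpr ⟨hcS, hfc⟩)
            rw [h1, hcost]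
            linarith
      · have hQpos : ∀ x ∈ S.filter (fun x => f x = d), 0 < v i x := fun x hx =>
          hpos x (mem_filter.mp hx).1
        have hQle : ∀ x ∈ S.filter (fun x => f x = d), v i x ≤ v i c := by
          intro x hx
          have hx := mem_filter.mp hx
          rcases List.mem_cons.mp (hfR x hx.1 hx.2) with h1 | h1
          · rw [h1]
          · exact hpw.1 x h1
        obtain ⟨T, hT, hTle, hTor⟩ : ∃ T ⊆ S.filter (fun x => f x = d),
            ∑ x ∈ T, v i x ≤ v i c ∧
            (T = S.filter (fun x => f x = d) ∨ ∑ x ∈ T, v i x = v i c) := by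
          rcases le_total (v i c) (∑ x ∈ S with f x = d, v i x) with h | h
          · obtain ⟨T, hT, he⟩ := exact_subset (v i) (S.filter (fun x => f x = d)) hQpos
              (fun x hx y hy => hfac x (mem_filter.mp hx).1 y (mem_filter.mp hy).1)
              (v i c) (hpos c hcS).le
              (fun x hx => by
                obtain ⟨q, _, hq⟩ := hfac x (mem_filter.mp hx).1 c hcS (hQle x hx)
                exact ⟨q, hq⟩) h
            exact ⟨T, hT, he.le, Or.inr he⟩
          · exact ⟨_, Subset.rfl, h, Or.inl rfl⟩
        have hTd : ∀ x ∈ T, x ∈ S ∧ f x = d := fun x hx => mem_filter.mp (hT hx)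
        have hfcd : f c < d := lt_of_le_of_ne (hfd c hcS) hfc
        refine ih (S.erase c) (insert c B) (fun x => if x ∈ T then f c else f x)
          hpos' hfac' hnd.2 hpw.2 hRS' hdis' ?_ ?_ ?_ ?_
        · intro x hx
          split_ifs
          · exact hfcd.le
          · exact hfd x (hsub x hx)
        · intro x hx h
          split_ifs at h
          · exact absurd h hfc
          · rcases List.mem_cons.mp (hfR x (hsub x hx) h) with h1 | h1
            · exact absurd h1 (mem_erase.mp hx).1
            · exact h1
        · intro j hj
          by_cases hjc : j = f c
          · subst hjc
            have h1 : (S.erase c).filter (fun x => (if x ∈ T then f c else f x) = f c)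
                ⊆ (S.filter (fun x => f x = f c)).erase c ∪ T := by
              intro x hx
              simp only [mem_filter, mem_erase, mem_union] at hx ⊢
              by_cases hxT : x ∈ T
              · exact Or.inr hxT
              · simp only [hxT, if_false] at hx
                exact Or.inl ⟨hx.1.1, hx.1.2, hx.2⟩
            have hd : Disjoint ((S.filter (fun x => f x = f c)).erase c) T := by
              rw [Finset.disjoint_left]
              intro x hx hxT
              have := (mem_filter.mp (mem_of_mem_erase hx)).2
              have := (hTd x hxT).2
              omega
            have h2 := add_sum_erase (S.filter (fun x => f x = f c)) (v i)
              (mem_filter.mpr ⟨hcS, rfl⟩)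
            have h3 := hsum (f c) hj
            have h4 : ∑ x ∈ S.erase c with (if x ∈ T then f c else f x) = f c, v i x
                ≤ ∑ x ∈ (S.filter (fun x => f x = f c)).erase c ∪ T, v i x := by
              refine sum_le_sum_of_subset_of_nonneg h1 ?_
              intro x hx _
              rcases mem_union.mp hx with h | h
              · exact (hpos x (mem_filter.mp (mem_of_mem_erase h)).1).le
              · exact (hpos x (hTd x h).1).le
            rw [sum_union hd] at h4
            linarith
          · refine le_trans (sum_le_sum_of_subset_of_nonneg ?_ ?_) (hsum j hj)
            · intro x hx
              simp only [mem_filter, mem_erase] at hx ⊢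
              refine ⟨hx.1.2, ?_⟩
              by_cases hxT : x ∈ T
              · simp only [hxT, if_true] at hx
                exact absurd hx.2.symm hjc
              · simpa only [hxT, if_false] using hx.2
            · intro x hx _
              exact (hpos x (mem_filter.mp hx).1).le
        · have hnone : T = S.filter (fun x => f x = d) →
              ∀ x ∈ S.erase c, (if x ∈ T then f c else f x) ≠ d := by
            intro hTe x hx h
            split_ifs at h with hxT
            · exact hfc h
            · exact hxT (hTe ▸ mem_filter.mpr ⟨hsub x hx, h⟩)
          rcases hTor with hTe | hTe
          · exact Or.inl (hnone hTe)
          · rcases hQ with h | h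
            · left
              apply hnone
              apply Subset.antisymm hT
              intro x hx
              exact absurd (mem_filter.mp hx).2 (h x (mem_filter.mp hx).1)
            · right
              have h1 : (S.erase c).filter (fun x => (if x ∈ T then f c else f x) = d)
                  = S.filter (fun x => f x = d) \ T := by
                ext x
                simp only [mem_filter, mem_erase, mem_sdiff]
                by_cases hxT : x ∈ T
                · simp [hxT, hfc]
                · simp only [hxT, if_false, not_false_eq_true, and_true]
                  constructor
                  · rintro ⟨⟨_, h1⟩, h2⟩
                    exact ⟨h1, h2⟩
                  · rintro ⟨h1, h2⟩
                    exact ⟨⟨fun h => hfc (h ▸ h2), h1⟩, h2⟩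
              have h2 := sum_sdiff (f := v i) hT
              rw [h1, hcost]
              linarith
    · push Not at hadd
      have hlt := hadd i hi
      rw [hcost] at hlt
      refine ih S B f hpos hfac hnd.2 hpw.2 (fun x hx => hRS x (by simp [hx])) hdis hfd ?_ hsum hQ
      intro x hx h
      rcases List.mem_cons.mp (hfR x hx h) with h1 | h1
      · exfalso
        subst h1
        rcases hQ with h2 | h2
        · exact h2 x hx h
        · have : v i x ≤ ∑ y ∈ S with f y = d, v i y :=
            single_le_sum (f := v i) (fun y hy => (hpos y (mem_filter.mp hy).1).le)
              (mem_filter.mpr ⟨hx, h⟩)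
          linarith
      · exact h1

lemma pack_step {n : ℕ} (v : Fin n → α → ℚ) (τ : Fin n → ℚ)
    (Ag : Finset (Fin n)) (i : Fin n) (hi : i ∈ Ag) (d : ℕ) (R : List α)
    (hpos : ∀ c ∈ R, 0 < v i c) (hfac : Factored (v i) R.toFinset)
    (hnd : R.Nodup) (hpw : R.Pairwise (fun c c' => v i c' ≤ v i c))
    (hp : Pack (v i) (τ i) (d + 1) R.toFinset) :
    Pack (v i) (τ i) d (R.filter fun c => c ∉ hffdBundle v τ Ag R ∅).toFinset := by
  obtain ⟨f, hf, hs⟩ := hp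
  have h := key v τ Ag i hi d R R.toFinset ∅ f (by simpa using hpos) hfac hnd hpw
    (by simp) (by simp) (fun c hc => Nat.lt_succ_iff.mp (hf c hc))
    (fun c hc _ => by simpa using hc) (fun j hj => hs j (by omega))
    (Or.inr (by simpa [bundleCost] using hs d (by omega)))
  convert h using 1
  ext x
  simp

/-- on an IDO factored instance, HFFD with each agent's threshold equal to
their maximin share allocates all chores. -/
theorem hffd_factored_at_mms_allocates_all
    (n : ℕ) (M : Finset α) (v : Fin n → α → ℚ)
    (hv : ∀ i, ∀ c ∈ M, 0 < v i c)
    (L : List α) (hL : IsUniversalOrder v M L)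
    (hfac : ∀ i, Factored (v i) M)
    (τ : Fin n → ℚ) (hτ : ∀ i, IsMMS (v i) M n (τ i))
    (σ : ℕ → Fin n) (hσ : ValidHFFDRun v τ L σ) :
    (hffdState v τ L σ n).1 = [] := by
  have hn : 0 < n := (σ 0).pos
  obtain ⟨hLM, hnd, hpw⟩ := hL
  obtain ⟨i, hi⟩ : ∃ i, i = σ (n - 1) := ⟨_, rfl⟩
  have hlast : i ∈ (hffdState v τ L σ (n - 1)).2 := hi ▸ (hσ (n - 1) (by omega)).1
  have hanti : Antitone fun k => (hffdState v τ L σ k).2 :=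
    antitone_nat_of_succ_le fun k => erase_subset _ _
  have hmem : ∀ k < n, i ∈ (hffdState v τ L σ k).2 := fun k hk =>
    hanti (by omega : k ≤ n - 1) hlast
  have hsubl : ∀ k, (hffdState v τ L σ k).1.Sublist L := by
    intro k
    induction k with
    | zero => exact List.Sublist.refl _
    | succ k ih => exact List.filter_sublist.trans ih
  have hinM : ∀ k, ∀ c ∈ (hffdState v τ L σ k).1, c ∈ M := fun k c hc => by
    rw [← hLM]; exact List.mem_toFinset.mpr ((hsubl k).subset hc)
  have hpack : ∀ k ≤ n, Pack (v i) (τ i) (n - k) (hffdState v τ L σ k).1.toFinset := by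
    intro k
    induction k with
    | zero =>
      intro _
      obtain ⟨⟨P, ⟨hP1, _, hP3⟩, hPc⟩, _⟩ := hτ i
      have hchoose : ∀ c, ∃ j : Fin n, c ∈ M → c ∈ P j := fun c => by
        by_cases hc : c ∈ M
        · obtain ⟨j, hj⟩ := hP3 c hc
          exact ⟨j, fun _ => hj⟩
        · exact ⟨i, fun h => absurd h hc⟩
      choose g hg using hchoose
      have h0 : (hffdState v τ L σ 0).1.toFinset = M := hLM
      rw [h0]
      refine ⟨fun c => (g c : ℕ), fun c _ => (g c).2, fun j hj => ?_⟩
      refine le_trans (sum_le_sum_of_subset_of_nonneg ?_ ?_) (hPc ⟨j, hj⟩)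
      · intro x hx
        have hx := mem_filter.mp hx
        have he : g x = ⟨j, hj⟩ := Fin.ext hx.2
        exact he ▸ hg x hx.1
      · intro x hx _
        exact (hv i x (hP1 _ hx)).le
    | succ k ih =>
      intro hk
      have hp := ih (by omega)
      rw [show n - k = (n - (k + 1)) + 1 by omega] at hp
      exact pack_step v τ _ i (hmem k (by omega)) _ _ (fun c hc => hv i c (hinM k c hc))
        (fun c hc c' hc' => hfac i c (hinM k c (by simpa using hc)) c'
          (hinM k c' (by simpa using hc')))
        (hnd.sublist (hsubl k)) ((hpw i).sublist (hsubl k)) hp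
  obtain ⟨f, hf, _⟩ := hpack n le_rfl
  rw [List.eq_nil_iff_forall_not_mem]
  intro c hc
  have := hf c (List.mem_toFinset.mpr hc)
  omega
end

section
/- Let v be a bivalued cost function with values s < l on a finite set M of chores, and suppose M can be partitioned into n bundles each of cost at most μ. Then for every threshold τ ≥ μ + s, FFD(M, v, τ) allocates all chores into at most n bins. -/
open Finset

variable {α : Type*} [DecidableEq α]

/-- Insert chore `c` into the first bin of the list whose cost stays at most `τ`;
open a new bin if it fits in no existing bin (and fits in an empty bin). -/
def ffdInsert (v : α → ℚ) (τ : ℚ) (c : α) : List (Finset α) → List (Finset α)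
  | [] => if v c ≤ τ then [{c}] else []
  | B :: rest =>
      if bundleCost v B + v c ≤ τ then insert c B :: rest
      else B :: ffdInsert v τ c rest

/-- The list of bins produced by FFD with threshold `τ` on the list `L` of chores
(processed in the order of `L`). -/
def ffdBins (v : α → ℚ) (τ : ℚ) (L : List α) : List (Finset α) :=
  L.foldl (fun bins c => ffdInsert v τ c bins) []

/-- `L` is a valid FFD processing order for `(M, v)`: an enumeration of `M`
in non-increasing order of cost. -/
def IsFFDList (v : α → ℚ) (M : Finset α) (L : List α) : Prop :=
  L.toFinset = M ∧ L.Nodup ∧ L.Pairwise fun c c' => v c' ≤ v c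

/-- FFD allocates all the chores into (at most) `n` bins. -/
def FFDAllocatesInto (v : α → ℚ) (τ : ℚ) (L : List α) (n : ℕ) : Prop :=
  (ffdBins v τ L).length ≤ n ∧ ∀ c ∈ L, ∃ B ∈ ffdBins v τ L, c ∈ B

/-- `v` is bivalued on `M` with values `s < l`. -/
def Bivalued (v : α → ℚ) (M : Finset α) (s l : ℚ) : Prop :=
  0 < s ∧ s < l ∧ ∀ c ∈ M, v c = s ∨ v c = l

theorem ffdInsert_mem (v : α → ℚ) (τ : ℚ) (c : α) (hc : v c ≤ τ) (bins : List (Finset α)) (x : α) :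
    (∃ B ∈ ffdInsert v τ c bins, x ∈ B) ↔ (x = c ∨ ∃ B ∈ bins, x ∈ B) := by
  induction bins with
  | nil => simp [ffdInsert, hc]
  | cons B rest ih =>
    unfold ffdInsert
    split_ifs with h
    · simp [or_assoc]
    · simp only [List.mem_cons, exists_eq_or_imp, ih]
      tauto

theorem ffdInsert_sum (v : α → ℚ) (τ : ℚ) (c : α) (hc : v c ≤ τ) (bins : List (Finset α))
    (hn : ∀ B ∈ bins, c ∉ B) :
    ((ffdInsert v τ c bins).map (bundleCost v)).sum = (bins.map (bundleCost v)).sum + v c := by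
  induction bins with
  | nil => simp [ffdInsert, hc, bundleCost]
  | cons B rest ih =>
    unfold ffdInsert
    split_ifs with h
    · have hB := hn B (by simp)
      simp only [List.map_cons, List.sum_cons]
      have : bundleCost v (insert c B) = v c + bundleCost v B := by
        simp [bundleCost, Finset.sum_insert hB]
      rw [this]; ring
    · simp only [List.map_cons, List.sum_cons]
      rw [ih (fun B hB => hn B (by simp [hB]))]; ring

theorem ffdInsert_length (v : α → ℚ) (τ : ℚ) (c : α) (bins : List (Finset α)) :
    (ffdInsert v τ c bins).length ≤ bins.length ∨
    ((ffdInsert v τ c bins).length ≤ bins.length + 1 ∧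
      ∀ B ∈ bins, τ < bundleCost v B + v c) := by
  induction bins with
  | nil => right; unfold ffdInsert; split_ifs <;> simp
  | cons B rest ih =>
    unfold ffdInsert
    split_ifs with h
    · left; simp
    · rcases ih with ih | ⟨ih, ih'⟩
      · left; simpa using ih
      · right
        refine ⟨by simpa using ih, ?_⟩
        intro B' hB'
        rcases List.mem_cons.1 hB' with rfl | hB'
        · exact not_le.1 h
        · exact ih' _ hB'

theorem ffd_inv
    (M : Finset α) (v : α → ℚ) (s l : ℚ) (hbv : Bivalued v M s l)
    (n : ℕ) (μ : ℚ) (P : Fin n → Finset α) (hP : IsPartitionInto M n P)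
    (hPμ : ∀ j, bundleCost v (P j) ≤ μ)
    (τ : ℚ) (hτ : μ + s ≤ τ) (p : List α) :
    (∀ x ∈ p, x ∈ M) → p.Nodup → (p.Pairwise fun c c' => v c' ≤ v c) →
    (ffdBins v τ p).length ≤ n ∧ (∀ x, (∃ B ∈ ffdBins v τ p, x ∈ B) ↔ x ∈ p) ∧
    ((ffdBins v τ p).map (bundleCost v)).sum = (p.map v).sum := by
  obtain ⟨hs, hsl, hv⟩ := hbv
  obtain ⟨hsub, hdisj, hcov⟩ := hP
  have hpos : ∀ x ∈ M, 0 < v x := fun x hx => by rcases hv x hx with h | h <;> linarith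
  induction p using List.reverseRecOn with
  | nil => intros; simp [ffdBins]
  | append_singleton p c ih =>
    intro hM hnd hpw
    have hMp : ∀ x ∈ p, x ∈ M := fun x hx => hM x (by simp [hx])
    have hcM : c ∈ M := hM c (by simp)
    have hpc : ∀ x ∈ p, v c ≤ v x := fun x hx =>
      (List.pairwise_append.1 hpw).2.2 x hx c (by simp)
    have hcp : c ∉ p := fun h => (List.nodup_append.1 hnd).2.2 c h c (by simp) rfl
    obtain ⟨h1, h2, h3⟩ := ih hMp (List.nodup_append.1 hnd).1 (List.pairwise_append.1 hpw).1
    have hstep : ffdBins v τ (p ++ [c]) = ffdInsert v τ c (ffdBins v τ p) := by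
      simp [ffdBins]
    have hle : ∀ Q : Finset α, ∀ j, ∑ x ∈ P j ∩ Q, v x ≤ μ := fun Q j =>
      (Finset.sum_le_sum_of_subset_of_nonneg Finset.inter_subset_left
        (fun x hx _ => (hpos x (hsub j hx)).le)).trans (hPμ j)
    have hcτ : v c ≤ τ := by
      obtain ⟨j, hj⟩ := hcov c hcM
      have := hle {c} j
      rw [Finset.inter_singleton_of_mem hj, Finset.sum_singleton] at this
      linarith
    rw [hstep]
    have hnc : ∀ B ∈ ffdBins v τ p, c ∉ B := fun B hB hc => hcp ((h2 c).1 ⟨B, hB, hc⟩)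
    refine ⟨?_, ?_, ?_⟩
    · rcases ffdInsert_length v τ c (ffdBins v τ p) with h | ⟨h, hfull⟩
      · omega
      by_contra hlen
      have hlen' : (ffdBins v τ p).length = n := by omega
      -- a common bound for the bins and the bundles
      obtain ⟨t, ht1, ht2⟩ : ∃ t : ℚ, (∀ B ∈ ffdBins v τ p, t ≤ bundleCost v B) ∧
          ∀ j, ∑ x ∈ P j ∩ (p ++ [c]).toFinset, v x ≤ t := by
        rcases hv c hcM with hc | hc
        · refine ⟨μ, fun B hB => ?_, hle _⟩
          have := hfull B hB
          linarith
        · have hl : 0 < l := by linarith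
          have hpl : ∀ x ∈ p, v x = l := fun x hx => by
            have := hpc x hx
            rcases hv x (hMp x hx) with h | h <;> linarith
          have hτ0 : 0 ≤ τ / l := by
            apply div_nonneg _ hl.le
            linarith
          refine ⟨(⌊τ / l⌋₊ : ℚ) * l, fun B hB => ?_, fun j => ?_⟩
          · have hB1 : bundleCost v B = B.card * l := by
              unfold bundleCost
              rw [Finset.sum_congr rfl (fun x hx => hpl x ((h2 x).1 ⟨B, hB, hx⟩))]
              simp
            have hf := hfull B hB
            rw [hB1, hc] at hf
            rw [hB1]
            have h4 : τ / l < B.card + 1 := by rw [div_lt_iff₀ hl]; linarith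
            have h5 : ⌊τ / l⌋₊ < B.card + 1 := by
              rw [Nat.floor_lt hτ0]; exact_mod_cast h4
            have h6 : ((⌊τ / l⌋₊ : ℕ) : ℚ) ≤ B.card := by exact_mod_cast Nat.lt_succ_iff.1 h5
            exact mul_le_mul_of_nonneg_right h6 hl.le
          · have hle' := hle (p ++ [c]).toFinset j
            have he : ∑ x ∈ P j ∩ (p ++ [c]).toFinset, v x
                = (P j ∩ (p ++ [c]).toFinset).card * l := by
              rw [Finset.sum_congr rfl (g := fun _ => l)]
              · simp
              · intro x hx
                have hx' := (Finset.mem_inter.1 hx).2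
                simp only [List.mem_toFinset, List.mem_append, List.mem_singleton] at hx'
                rcases hx' with hx' | rfl
                · exact hpl x hx'
                · exact hc
            rw [he] at hle' ⊢
            refine mul_le_mul_of_nonneg_right ?_ hl.le
            have : (P j ∩ (p ++ [c]).toFinset).card ≤ ⌊τ / l⌋₊ := by
              apply Nat.le_floor
              rw [le_div_iff₀ hl]; linarith
            exact_mod_cast this
      have hA : (n : ℚ) * t ≤ (p.map v).sum := by
        rw [← h3, ← hlen']
        have := List.card_nsmul_le_sum ((ffdBins v τ p).map (bundleCost v)) t (by
          intro x hx
          obtain ⟨B, hB, rfl⟩ := List.mem_map.1 hx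
          exact ht1 B hB)
        simpa using this
      have hB : ((p ++ [c]).map v).sum ≤ n * t := by
        rw [← List.sum_toFinset v hnd]
        calc ∑ x ∈ (p ++ [c]).toFinset, v x
            ≤ ∑ x ∈ Finset.univ.biUnion (fun j => P j ∩ (p ++ [c]).toFinset), v x := by
              apply le_of_eq
              congr 1
              ext x
              simp only [Finset.mem_biUnion, Finset.mem_univ, true_and, Finset.mem_inter]
              constructor
              · intro hx
                obtain ⟨j, hj⟩ := hcov x (hM x (List.mem_toFinset.1 hx))
                exact ⟨j, hj, hx⟩
              · rintro ⟨j, _, hx⟩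
                exact hx
          _ = ∑ j, ∑ x ∈ P j ∩ (p ++ [c]).toFinset, v x := by
              apply Finset.sum_biUnion
              intro i _ j _ hij
              exact (hdisj i j hij).mono Finset.inter_subset_left Finset.inter_subset_left
          _ ≤ ∑ j : Fin n, t := Finset.sum_le_sum (fun j _ => ht2 j)
          _ = n * t := by simp
      have := hpos c hcM
      simp only [List.map_append, List.sum_append, List.map_cons, List.map_nil,
        List.sum_cons, List.sum_nil] at hB
      linarith
    · intro x
      rw [ffdInsert_mem v τ c hcτ, h2]
      simp [or_comm]
    · rw [ffdInsert_sum v τ c hcτ _ hnc, h3]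
      simp

/-- for a bivalued cost function, if `M` can be partitioned into `n` bundles
each of cost at most `μ`, then FFD with any threshold `τ ≥ μ + s` allocates all chores
into at most `n` bins. -/
theorem ffd_bivalued_mu_plus_s
    (M : Finset α) (v : α → ℚ) (s l : ℚ) (hbv : Bivalued v M s l)
    (n : ℕ) (μ : ℚ)
    (hpart : ∃ P : Fin n → Finset α, IsPartitionInto M n P ∧ ∀ j, bundleCost v (P j) ≤ μ)
    (τ : ℚ) (hτ : μ + s ≤ τ)
    (L : List α) (hL : IsFFDList v M L) :
    FFDAllocatesInto v τ L n := by
  obtain ⟨P, hP, hPμ⟩ := hpart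
  obtain ⟨rfl, hnd, hpw⟩ := hL
  obtain ⟨h1, h2, -⟩ := ffd_inv L.toFinset v s l hbv n μ P hP hPμ τ hτ L
    (fun x hx => List.mem_toFinset.2 hx) hnd hpw
  exact ⟨h1, fun c hc => (h2 c).2 hc⟩
end
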